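/- Let p ≥ 3 be a prime and let 3 ≤ r < s be integers such that (r-1) ∤ (s-1) and (r-1) ∤ s. Let g be the least positive residue of s-1 modulo r-1, assume 2g ≤ r-2 and (g+1) ∤ (r-g-1), and set q_1 = (r-g-1)/(g+1). If a ∈ A(s,r) satisfies h_p(a) = min h_p, then d = (d_1,…,d_{r-1}) := δ(a) has the following properties: (1) exactly g entries of d equal [q+1], but d_1 ≠ [q+1] and d_{r-1} ≠ [q+1], and no two consecutive entries d_j = d_{j+1} = [q+1] occur; (2) the remaining r-g-1 entries of d all equal [q] and appear in maximal blocks of consecutive entries of length [q_1] or [q_1]+1, and there are exactly f blocks of length [q_1]+1 and exactly g+1-f blocks of length [q_1], where f is the least positive residue of r-g-1 modulo g+1. -/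

import Mathlib

/-- `A(s,r)`: admissible exponent tuples, viewed as functions `ℕ → ℤ` whose relevant
entries are indices `0,…,r-1`: strictly increasing with `a 0 = 0` and `a (r-1) = s-1`. -/
def Admissible (s r : ℕ) (a : ℕ → ℤ) : Prop :=
  a 0 = 0 ∧ a (r - 1) = (s : ℤ) - 1 ∧ ∀ i, i + 1 < r → a i < a (i + 1)

/-- `h_p(x) = Σ_{k<i≤r} p^{-(x_i - x_k)}` (indices `0,…,r-1`). -/
noncomputable def hp (p r : ℕ) (a : ℕ → ℤ) : ℝ :=
  ∑ k ∈ Finset.range r, ∑ i ∈ Finset.range r,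
    if k < i then (p : ℝ) ^ (a k - a i) else 0

/-- `a` is admissible and attains `min h_p` over `A(s,r)`. -/
def IsMinimizer (p s r : ℕ) (a : ℕ → ℤ) : Prop :=
  Admissible s r a ∧ ∀ b : ℕ → ℤ, Admissible s r b → hp p r a ≤ hp p r b

/-- The delta vector of `a`: `δ_j(a) = a_{j+1} - a_j`, relevant for `j = 0,…,r-2`. -/
def dlt (a : ℕ → ℤ) (j : ℕ) : ℤ := a (j + 1) - a j

/-- `IsMaxRun n d v i l`: within the vector `(d 0, …, d (n-1))`, the entries
`d i, …, d (i+l-1)` form a maximal block of consecutive entries equal to `v`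
(of length `l ≥ 1`). -/
def IsMaxRun (n : ℕ) (d : ℕ → ℤ) (v : ℤ) (i l : ℕ) : Prop :=
  0 < l ∧ i + l ≤ n ∧ (∀ k < l, d (i + k) = v) ∧
    (0 < i → d (i - 1) ≠ v) ∧ (i + l < n → d (i + l) ≠ v)

section Potentials

/-- Sum of `p ^ (a k - a i)` over pairs `k < i` inside the index interval `[u, v)`. -/
noncomputable def innerEnergy (p : ℕ) (a : ℕ → ℤ) (u v : ℕ) : ℝ :=
  ∑ k ∈ Finset.Ico u v, ∑ i ∈ Finset.Ico u v, if k < i then (p : ℝ) ^ (a k - a i) else 0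

/-- Sum of `p ^ (a k - a i)` over `k ∈ [u, v)` and `i ∈ [u', v')`. -/
noncomputable def crossEnergy (p : ℕ) (a : ℕ → ℤ) (u v u' v' : ℕ) : ℝ :=
  ∑ k ∈ Finset.Ico u v, ∑ i ∈ Finset.Ico u' v', (p : ℝ) ^ (a k - a i)

/-- Potential at `a j` of the points with index in `[i, j)`. -/
noncomputable def leftPot (p : ℕ) (a : ℕ → ℤ) (i j : ℕ) : ℝ :=
  ∑ k ∈ Finset.Ico i j, (p : ℝ) ^ (a k - a j)

/-- Potential at `a i` of the points with index in `(i, j]`. -/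
noncomputable def rightPot (p : ℕ) (a : ℕ → ℤ) (i j : ℕ) : ℝ :=
  ∑ k ∈ Finset.Ico (i + 1) (j + 1), (p : ℝ) ^ (a i - a k)

variable {p : ℕ} {a b : ℕ → ℤ}

lemma hp_split {r u v : ℕ} (huv : u ≤ v) (hvr : v ≤ r) :
    hp p r a = innerEnergy p a 0 u + innerEnergy p a u v + innerEnergy p a v r
      + crossEnergy p a 0 u u v + crossEnergy p a u v v r + crossEnergy p a 0 u v r := by
  have split : ∀ f : ℕ → ℝ, ∑ k ∈ Finset.range r, f k
      = ∑ k ∈ Finset.Ico 0 u, f k + ∑ k ∈ Finset.Ico u v, f k + ∑ k ∈ Finset.Ico v r, f k := by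
    intro f
    rw [Finset.sum_Ico_consecutive f (Nat.zero_le u) huv,
      Finset.sum_Ico_consecutive f (Nat.zero_le v) hvr, Finset.range_eq_Ico]
  have cross : ∀ u₁ v₁ u₂ v₂ : ℕ, v₁ ≤ u₂ →
      ∑ k ∈ Finset.Ico u₁ v₁, ∑ i ∈ Finset.Ico u₂ v₂,
        (if k < i then (p : ℝ) ^ (a k - a i) else 0) = crossEnergy p a u₁ v₁ u₂ v₂ := by
    intro u₁ v₁ u₂ v₂ h
    refine Finset.sum_congr rfl fun k hk => Finset.sum_congr rfl fun i hi => ?_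
    rw [Finset.mem_Ico] at hk hi
    rw [if_pos (by omega)]
  have zero : ∀ u₁ v₁ u₂ v₂ : ℕ, v₁ ≤ u₂ →
      ∑ k ∈ Finset.Ico u₂ v₂, ∑ i ∈ Finset.Ico u₁ v₁,
        (if k < i then (p : ℝ) ^ (a k - a i) else 0) = 0 := by
    intro u₁ v₁ u₂ v₂ h
    refine Finset.sum_eq_zero fun k hk => Finset.sum_eq_zero fun i hi => ?_
    rw [Finset.mem_Ico] at hk hi
    rw [if_neg (by omega)]
  unfold hp
  simp only [split, Finset.sum_add_distrib]
  rw [cross 0 u u v le_rfl, cross u v v r le_rfl, cross 0 u v r huv,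
    zero 0 u u v le_rfl, zero u v v r le_rfl, zero 0 u v r huv]
  unfold innerEnergy
  ring

lemma innerEnergy_congr {u v : ℕ} (h : ∀ k, u ≤ k → k < v → ∀ i, u ≤ i → i < v →
    a k - a i = b k - b i) : innerEnergy p a u v = innerEnergy p b u v := by
  refine Finset.sum_congr rfl fun k hk => Finset.sum_congr rfl fun i hi => ?_
  rw [Finset.mem_Ico] at hk hi
  rw [h k hk.1 hk.2 i hi.1 hi.2]

lemma crossEnergy_eq_mul {u v u' v' : ℕ} (hp0 : (p : ℝ) ≠ 0) (c : ℤ)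
    (h : ∀ k, u ≤ k → k < v → ∀ i, u' ≤ i → i < v' → b k - b i = c + (a k - a i)) :
    crossEnergy p b u v u' v' = (p : ℝ) ^ c * crossEnergy p a u v u' v' := by
  simp only [crossEnergy, Finset.mul_sum]
  refine Finset.sum_congr rfl fun k hk => Finset.sum_congr rfl fun i hi => ?_
  rw [Finset.mem_Ico] at hk hi
  rw [h k hk.1 hk.2 i hi.1 hi.2, zpow_add₀ hp0]

lemma crossEnergy_eq_sum_mul_sum {u v u' v' : ℕ} (hp0 : (p : ℝ) ≠ 0) (c : ℤ) :
    crossEnergy p a u v u' v' = (∑ k ∈ Finset.Ico u v, (p : ℝ) ^ (a k - c)) *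
      ∑ i ∈ Finset.Ico u' v', (p : ℝ) ^ (c - a i) := by
  simp only [crossEnergy, Finset.sum_mul_sum]
  refine Finset.sum_congr rfl fun k _ => Finset.sum_congr rfl fun i _ => ?_
  rw [← zpow_add₀ hp0]
  congr 1
  ring

lemma leftPot_nonneg (i j : ℕ) : 0 ≤ leftPot p a i j :=
  Finset.sum_nonneg fun _ _ => by positivity

lemma rightPot_nonneg (i j : ℕ) : 0 ≤ rightPot p a i j :=
  Finset.sum_nonneg fun _ _ => by positivity

lemma sum_Ico_eq_one_add_leftPot {i j : ℕ} (hij : i ≤ j) :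
    ∑ k ∈ Finset.Ico i (j + 1), (p : ℝ) ^ (a k - a j) = 1 + leftPot p a i j := by
  rw [Finset.sum_Ico_succ_top hij, sub_self, zpow_zero, add_comm, leftPot]

lemma sum_Ico_eq_one_add_rightPot {i j : ℕ} (hij : i ≤ j) :
    ∑ k ∈ Finset.Ico i (j + 1), (p : ℝ) ^ (a i - a k) = 1 + rightPot p a i j := by
  rw [Finset.sum_eq_sum_Ico_succ_bot (by omega), sub_self, zpow_zero, rightPot]

lemma leftPot_succ (hp0 : (p : ℝ) ≠ 0) {i j : ℕ} (hij : i ≤ j) :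
    leftPot p a i (j + 1) = (p : ℝ) ^ (-dlt a j) * (1 + leftPot p a i j) := by
  rw [← sum_Ico_eq_one_add_leftPot hij, leftPot, Finset.mul_sum]
  refine Finset.sum_congr rfl fun k _ => ?_
  rw [← zpow_add₀ hp0, dlt]
  congr 1
  ring

lemma rightPot_of_lt (hp0 : (p : ℝ) ≠ 0) {i j : ℕ} (hij : i < j) :
    rightPot p a i j = (p : ℝ) ^ (-dlt a i) * (1 + rightPot p a (i + 1) j) := by
  rw [← sum_Ico_eq_one_add_rightPot (show i + 1 ≤ j from hij), rightPot, Finset.mul_sum]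
  refine Finset.sum_congr rfl fun k _ => ?_
  rw [← zpow_add₀ hp0, dlt]
  congr 1
  ring

lemma zpow_neg_le_third (hp3 : 3 ≤ p) {d : ℤ} (hd : 0 < d) : (p : ℝ) ^ (-d) ≤ 1 / 3 := by
  have h3 : (3 : ℝ) ≤ p := by exact_mod_cast hp3
  calc (p : ℝ) ^ (-d) ≤ (p : ℝ) ^ (-1 : ℤ) := zpow_le_zpow_right₀ (by linarith) (by omega)
    _ = 1 / p := by rw [zpow_neg_one, one_div]
    _ ≤ 1 / 3 := one_div_le_one_div_of_le (by norm_num) h3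

lemma leftPot_lt_half (hp3 : 3 ≤ p) {i j : ℕ} (hij : i ≤ j) (h : ∀ k < j, 0 < dlt a k) :
    leftPot p a i j < 1 / 2 := by
  induction j, hij using Nat.le_induction with
  | base => norm_num [leftPot]
  | succ j hij ih =>
    have h1 := ih fun k hk => h k (by omega)
    rw [leftPot_succ (by norm_cast; omega) hij]
    have h2 := zpow_neg_le_third hp3 (h j (by omega))
    nlinarith [leftPot_nonneg (p := p) (a := a) i j]

lemma rightPot_lt_half (hp3 : 3 ≤ p) {i j : ℕ} (hij : i ≤ j) (h : ∀ k < j, 0 < dlt a k) :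
    rightPot p a i j < 1 / 2 := by
  induction hm : j - i generalizing i with
  | zero => rw [show i = j by omega]; norm_num [rightPot]
  | succ m ih =>
    have h1 := ih (i := i + 1) (by omega) (by omega)
    rw [rightPot_of_lt (by norm_cast; omega) (by omega)]
    have h2 := zpow_neg_le_third hp3 (h i (by omega))
    nlinarith [rightPot_nonneg (p := p) (a := a) (i + 1) j]

lemma zpow_neg_pred_mul_lt {p : ℕ} (hp3 : 3 ≤ p) {Q c d : ℤ} (hc : c ≤ Q) (hd : Q + 1 ≤ d)
    {x y : ℝ} (hx : 0 ≤ x) (hy : y < 1 / 2) :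
    (p : ℝ) ^ (-d) * (1 + y) < (p : ℝ) ^ (-c) * (1 + x) := by
  have h3 : (3 : ℝ) ≤ p := by exact_mod_cast hp3
  have h1 : (p : ℝ) ^ (-c) = (p : ℝ) ^ (-d) * (p : ℝ) ^ (d - c) := by
    rw [← zpow_add₀ (by linarith)]; congr 1; ring
  have h2 : (3 : ℝ) ≤ (p : ℝ) ^ (d - c) := by
    calc (3 : ℝ) ≤ (p : ℝ) ^ (1 : ℤ) := by simpa using h3
      _ ≤ _ := zpow_le_zpow_right₀ (by linarith) (by omega)
  have h4 : 0 < (p : ℝ) ^ (-d) := by positivity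
  rw [h1, mul_assoc]
  exact mul_lt_mul_of_pos_left (by nlinarith) h4

/-- Lexicographic comparison of potentials: outward from `j` there are `m` gaps `≥ Q` followed by
a gap `> Q` or the end, whereas outward from `i` there are at least `m + 1` gaps `Q`. -/
lemma rightPot_lt_leftPot (hp3 : 3 ≤ p) {n : ℕ} (hpos : ∀ k < n, 0 < dlt a k) {Q : ℤ} (m : ℕ) :
    ∀ i j : ℕ, i + m + 1 ≤ n → (∀ l ≤ m, dlt a (i + l) = Q) → j + m ≤ n →
      (∀ l < m, Q ≤ dlt a (j + l)) → (j + m < n → dlt a (j + m) = Q + 1) →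
      rightPot p a j n < leftPot p a 0 (i + m + 1) := by
  have hp0 : (p : ℝ) ≠ 0 := by norm_cast; omega
  have hp1 : (1 : ℝ) ≤ p := by norm_cast; omega
  induction m with
  | zero =>
    intro i j hi hz hj _ hend
    have hQ := hz 0 le_rfl
    simp only [add_zero] at hQ hj hend ⊢
    rw [leftPot_succ hp0 (Nat.zero_le i), hQ]
    have hL := leftPot_nonneg (p := p) (a := a) 0 i
    rcases hj.eq_or_lt with rfl | hj
    · have : rightPot p a j j = 0 := by simp [rightPot]
      rw [this]; positivity
    · rw [rightPot_of_lt hp0 hj, hend hj]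
      exact zpow_neg_pred_mul_lt hp3 le_rfl le_rfl hL
        (rightPot_lt_half hp3 hj hpos)
  | succ m ih =>
    intro i j hi hz hj hge hend
    have key := ih i (j + 1) (by omega) (fun l hl => hz l (by omega)) (by omega)
      (fun l hl => by have := hge (l + 1) (by omega); rwa [show j + 1 + l = j + (l + 1) by ring])
      (fun h => by rw [show j + 1 + m = j + (m + 1) by ring]; exact hend (by omega))
    rw [show i + (m + 1) + 1 = (i + m + 1) + 1 by ring, leftPot_succ hp0 (Nat.zero_le _),
      rightPot_of_lt hp0 (by omega), show i + m + 1 = i + (m + 1) by ring, hz (m + 1) le_rfl]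
    have h0 := hge 0 (by omega)
    rw [add_zero] at h0
    calc (p : ℝ) ^ (-dlt a j) * (1 + rightPot p a (j + 1) n)
        ≤ (p : ℝ) ^ (-Q) * (1 + rightPot p a (j + 1) n) := by
          refine mul_le_mul_of_nonneg_right (zpow_le_zpow_right₀ hp1 (by omega)) ?_
          linarith [rightPot_nonneg (p := p) (a := a) (j + 1) n]
      _ < _ := by
          refine mul_lt_mul_of_pos_left ?_ (by positivity)
          rw [show i + (m + 1) = i + m + 1 by ring]
          linarith

end Potentials

section Exchange

variable {p s r : ℕ} {a : ℕ → ℤ}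

lemma Admissible.dlt_pos (ha : Admissible s r a) : ∀ k < r - 1, 0 < dlt a k := by
  intro k hk
  have := ha.2.2 k (by omega)
  rw [dlt]; omega

/-- The reflection `k ↦ s - 1 - a (r - 1 - k)` of a configuration. -/
def reflectTuple (s r : ℕ) (a : ℕ → ℤ) (k : ℕ) : ℤ := (s : ℤ) - 1 - a (r - 1 - k)

lemma dlt_reflect {k : ℕ} (hk : k < r - 1) : dlt (reflectTuple s r a) k = dlt a (r - 2 - k) := by
  unfold dlt reflectTuple
  rw [show r - 2 - k + 1 = r - 1 - k by omega, show r - 1 - (k + 1) = r - 2 - k by omega]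
  ring

lemma hp_reflect : hp p r (reflectTuple s r a) = hp p r a := by
  unfold hp
  rw [← Finset.sum_range_reflect, Finset.sum_comm, ← Finset.sum_range_reflect]
  refine Finset.sum_congr rfl fun k hk => Finset.sum_congr rfl fun i hi => ?_
  rw [Finset.mem_range] at hk hi
  by_cases h : k < i
  · rw [if_pos h, if_pos (by omega)]
    unfold reflectTuple
    congr 1
    rw [show r - 1 - (r - 1 - i) = i by omega, show r - 1 - (r - 1 - k) = k by omega]
    ring
  · rw [if_neg h, if_neg (by omega)]

lemma IsMinimizer.reflect (ha : IsMinimizer p s r a) :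
    IsMinimizer p s r (reflectTuple s r a) := by
  refine ⟨⟨?_, ?_, ?_⟩, ?_⟩
  · simp [reflectTuple, ha.1.2.1]
  · simp [reflectTuple, ha.1.1]
  · intro i hi
    have h := ha.1.2.2 (r - 2 - i) (by omega)
    rw [show r - 2 - i + 1 = r - 1 - i by omega] at h
    unfold reflectTuple
    rw [show r - 1 - (i + 1) = r - 2 - i by omega]
    omega
  · intro b hb
    rw [hp_reflect]
    exact ha.2 b hb

lemma IsMinimizer.dlt_le_of_lt (hp3 : 3 ≤ p) (ha : IsMinimizer p s r a) {i j : ℕ} (hij : i < j)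
    (hj : j < r - 1) : dlt a i ≤ dlt a j + 1 := by
  by_contra! hlt
  have h3 : (3 : ℝ) ≤ p := by exact_mod_cast hp3
  have hp0 : (p : ℝ) ≠ 0 := by linarith
  have hpos := ha.1.dlt_pos
  set b : ℕ → ℤ := fun k => if i < k ∧ k ≤ j then a k - 1 else a k with hb
  have hbout : ∀ k, ¬ (i < k ∧ k ≤ j) → b k = a k := fun k hk => if_neg hk
  have hbin : ∀ k, i < k → k ≤ j → b k = a k - 1 := fun k h1 h2 => if_pos ⟨h1, h2⟩
  have hadm : Admissible s r b := by
    refine ⟨?_, ?_, ?_⟩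
    · rw [hbout 0 (by omega), ha.1.1]
    · rw [hbout _ (by omega), ha.1.2.1]
    · intro k hk
      have h1 := ha.1.2.2 k hk
      have h2 := hpos j hj
      by_cases hk1 : i < k ∧ k ≤ j
      · rw [hbin k hk1.1 hk1.2]
        by_cases hk2 : k + 1 ≤ j
        · rw [hbin (k + 1) (by omega) hk2]; omega
        · rw [hbout (k + 1) (by omega)]; omega
      · rw [hbout k hk1]
        by_cases hk2 : i = k
        · subst hk2
          rw [hbin (i + 1) (by omega) (by omega)]
          simp only [dlt] at hlt h2
          omega
        · rw [hbout (k + 1) (by omega)]; omega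
  have hmin := ha.2 b hadm
  rw [hp_split (a := a) (u := i + 1) (v := j + 1) (by omega) (by omega : j + 1 ≤ r),
    hp_split (a := b) (u := i + 1) (v := j + 1) (by omega) (by omega : j + 1 ≤ r)] at hmin
  rw [innerEnergy_congr (a := b) (b := a) (u := 0) (v := i + 1)
      (fun k _ _ l _ _ => by rw [hbout k (by omega), hbout l (by omega)]),
    innerEnergy_congr (a := b) (b := a) (u := i + 1) (v := j + 1)
      (fun k _ _ l _ _ => by
        rw [hbin k (by omega) (by omega), hbin l (by omega) (by omega)]; ring),
    innerEnergy_congr (a := b) (b := a) (u := j + 1) (v := r)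
      (fun k _ _ l _ _ => by rw [hbout k (by omega), hbout l (by omega)]),
    crossEnergy_eq_mul (a := a) (b := b) (u := 0) (v := i + 1) (u' := i + 1) (v' := j + 1) hp0 1
      (fun k _ _ l _ _ => by rw [hbout k (by omega), hbin l (by omega) (by omega)]; ring),
    crossEnergy_eq_mul (a := a) (b := b) (u := i + 1) (v := j + 1) (u' := j + 1) (v' := r) hp0 (-1)
      (fun k _ _ l _ _ => by rw [hbin k (by omega) (by omega), hbout l (by omega)]; ring),
    crossEnergy_eq_mul (a := a) (b := b) (u := 0) (v := i + 1) (u' := j + 1) (v' := r) hp0 0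
      (fun k _ _ l _ _ => by rw [hbout k (by omega), hbout l (by omega)]; ring)] at hmin
  rw [zpow_zero, one_mul, zpow_one, zpow_neg_one] at hmin
  set X := crossEnergy p a 0 (i + 1) (i + 1) (j + 1) with hX
  set Y := crossEnergy p a (i + 1) (j + 1) (j + 1) r with hY
  have hYX : Y ≤ p * X := by
    have h1 : 0 ≤ (p - 1) * (p * X - Y) := by
      have h2 : (0 : ℝ) ≤ p * (p * X + (p : ℝ)⁻¹ * Y - X - Y) :=
        mul_nonneg (by linarith) (by linarith)
      have h4 : (p : ℝ) * (p * X + (p : ℝ)⁻¹ * Y - X - Y) = (p - 1) * (p * X - Y) := by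
        field_simp; ring
      rwa [← h4]
    have := nonneg_of_mul_nonneg_right h1 (by linarith)
    linarith
  have hXe : X = (1 + leftPot p a 0 i) * ((p : ℝ) ^ (-dlt a i) * (1 + rightPot p a (i + 1) j)) := by
    rw [hX, crossEnergy_eq_sum_mul_sum hp0 (a i), sum_Ico_eq_one_add_leftPot (Nat.zero_le i)]
    congr 1
    rw [← rightPot_of_lt hp0 hij, rightPot]
  have hYe : Y = (1 + leftPot p a (i + 1) j) *
      ((p : ℝ) ^ (-dlt a j) * (1 + rightPot p a (j + 1) (r - 1))) := by
    rw [hY, crossEnergy_eq_sum_mul_sum hp0 (a j),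
      sum_Ico_eq_one_add_leftPot (show i + 1 ≤ j from hij)]
    congr 1
    rw [← rightPot_of_lt hp0 hj, rightPot, show r - 1 + 1 = r by omega]
  have hL := leftPot_lt_half (i := 0) hp3 (Nat.zero_le i) fun k hk => hpos k (by omega)
  have hR := rightPot_lt_half hp3 (show i + 1 ≤ j from hij) fun k hk => hpos k (by omega)
  have hL0 := leftPot_nonneg (p := p) (a := a) 0 i
  have hR0 := rightPot_nonneg (p := p) (a := a) (i + 1) j
  have hpow : p * (p * (p : ℝ) ^ (-dlt a i)) ≤ (p : ℝ) ^ (-dlt a j) := by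
    calc p * (p * (p : ℝ) ^ (-dlt a i)) = (p : ℝ) ^ (1 + (1 + -dlt a i)) := by
          rw [zpow_add₀ hp0, zpow_add₀ hp0, zpow_one]
      _ ≤ _ := zpow_le_zpow_right₀ (by linarith) (by omega)
  have hx : 0 < (p : ℝ) ^ (-dlt a i) := by positivity
  have hy : 0 < (p : ℝ) ^ (-dlt a j) := by positivity
  have hYge : (p : ℝ) ^ (-dlt a j) ≤ Y := by
    rw [hYe]
    have h1 := leftPot_nonneg (p := p) (a := a) (i + 1) j
    have h2 := rightPot_nonneg (p := p) (a := a) (j + 1) (r - 1)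
    nlinarith [mul_nonneg hy.le h1, mul_nonneg hy.le h2, mul_nonneg (mul_nonneg hy.le h1) h2]
  have hXle : X ≤ 9 / 4 * (p : ℝ) ^ (-dlt a i) := by
    rw [hXe]
    have : (1 + leftPot p a 0 i) * (1 + rightPot p a (i + 1) j) ≤ 9 / 4 := by nlinarith
    nlinarith
  nlinarith [mul_pos (show (0 : ℝ) < p by linarith) hx]

lemma IsMinimizer.dlt_le (hp3 : 3 ≤ p) (ha : IsMinimizer p s r a) {i j : ℕ} (hi : i < r - 1)
    (hj : j < r - 1) : dlt a i ≤ dlt a j + 1 := by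
  rcases lt_trichotomy i j with h | rfl | h
  · exact ha.dlt_le_of_lt hp3 h hj
  · omega
  · have := ha.reflect.dlt_le_of_lt hp3 (i := r - 2 - i) (j := r - 2 - j) (by omega) (by omega)
    rwa [dlt_reflect (by omega), dlt_reflect (by omega), show r - 2 - (r - 2 - i) = i by omega,
      show r - 2 - (r - 2 - j) = j by omega] at this

/-- Reversing the configuration strictly between the points `a i` and `a j` does not decrease the
energy. -/
lemma IsMinimizer.reverse_segment (hp3 : 3 ≤ p) (ha : IsMinimizer p s r a) {i j : ℕ}
    (hij : i + 1 < j) (hj : j ≤ r - 1) :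
    0 ≤ (rightPot p a j (r - 1) - leftPot p a 0 i) *
      (rightPot p a i (j - 1) - leftPot p a (i + 1) j) := by
  have hp0 : (p : ℝ) ≠ 0 := by norm_cast; omega
  set b : ℕ → ℤ := fun k => if i < k ∧ k < j then a i + a j - a (i + j - k) else a k with hb
  have hbout : ∀ k, ¬ (i < k ∧ k < j) → b k = a k := fun k hk => if_neg hk
  have hbin : ∀ k, i < k → k < j → b k = a i + a j - a (i + j - k) :=
    fun k h1 h2 => if_pos ⟨h1, h2⟩
  have hbmid : ∀ k, i ≤ k → k ≤ j → b k = a i + a j - a (i + j - k) := by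
    intro k h1 h2
    rcases h1.eq_or_lt with rfl | h1
    · rw [hbout i (by omega), show i + j - i = j by omega]; ring
    rcases h2.eq_or_lt with rfl | h2
    · rw [hbout k (by omega), show i + k - k = i by omega]; ring
    exact hbin k h1 h2
  have hadm : Admissible s r b := by
    refine ⟨?_, ?_, ?_⟩
    · rw [hbout 0 (by omega), ha.1.1]
    · rw [hbout _ (by omega), ha.1.2.1]
    · intro k hk
      by_cases hk1 : i ≤ k ∧ k < j
      · rw [hbmid k hk1.1 (by omega), hbmid (k + 1) (by omega) (by omega)]
        have := ha.1.2.2 (i + j - (k + 1)) (by omega)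
        rw [show i + j - (k + 1) + 1 = i + j - k by omega] at this
        omega
      · rw [hbout k (by omega), hbout (k + 1) (by omega)]
        exact ha.1.2.2 k hk
  have hmin := ha.2 b hadm
  have hreflect : ∀ f : ℕ → ℝ, ∑ k ∈ Finset.Ico (i + 1) j, f (i + j - k)
      = ∑ k ∈ Finset.Ico (i + 1) j, f k := by
    intro f
    refine Finset.sum_nbij' (fun k => i + j - k) (fun k => i + j - k) ?_ ?_ ?_ ?_
      (fun _ _ => rfl) <;> intro k hk <;> rw [Finset.mem_Ico] at hk
    · exact Finset.mem_Ico.2 (by omega)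
    · exact Finset.mem_Ico.2 (by omega)
    · exact Nat.sub_sub_self (by omega)
    · exact Nat.sub_sub_self (by omega)
  have hinner : innerEnergy p b (i + 1) j = innerEnergy p a (i + 1) j := by
    unfold innerEnergy
    rw [← hreflect, Finset.sum_comm, ← hreflect]
    refine Finset.sum_congr rfl fun k hk => Finset.sum_congr rfl fun l hl => ?_
    rw [Finset.mem_Ico] at hk hl
    by_cases h : k < l
    · rw [if_pos (by omega), if_pos h, hbin _ (by omega) (by omega),
        hbin _ (by omega) (by omega), show i + j - (i + j - l) = l by omega,
        show i + j - (i + j - k) = k by omega]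
      congr 1
      ring
    · rw [if_neg (by omega), if_neg h]
  rw [hp_split (a := a) (u := i + 1) (v := j) (by omega) (by omega : j ≤ r),
    hp_split (a := b) (u := i + 1) (v := j) (by omega) (by omega : j ≤ r)] at hmin
  rw [innerEnergy_congr (a := b) (b := a) (u := 0) (v := i + 1)
      (fun k _ _ l _ _ => by rw [hbout k (by omega), hbout l (by omega)]),
    hinner,
    innerEnergy_congr (a := b) (b := a) (u := j) (v := r)
      (fun k _ _ l _ _ => by rw [hbout k (by omega), hbout l (by omega)]),
    crossEnergy_eq_mul (a := a) (b := b) (u := 0) (v := i + 1) (u' := j) (v' := r) hp0 0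
      (fun k _ _ l _ _ => by rw [hbout k (by omega), hbout l (by omega)]; ring),
    zpow_zero, one_mul] at hmin
  have hleft : ∑ k ∈ Finset.Ico 0 (i + 1), (p : ℝ) ^ (b k - a i) = 1 + leftPot p a 0 i := by
    rw [← sum_Ico_eq_one_add_leftPot (Nat.zero_le i)]
    refine Finset.sum_congr rfl fun k hk => ?_
    rw [Finset.mem_Ico] at hk
    rw [hbout k (by omega)]
  have hright' : ∑ k ∈ Finset.Ico j r, (p : ℝ) ^ (a j - a k) = 1 + rightPot p a j (r - 1) := by
    rw [← sum_Ico_eq_one_add_rightPot (by omega), show r - 1 + 1 = r by omega]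
  have hright : ∑ k ∈ Finset.Ico j r, (p : ℝ) ^ (a j - b k) = 1 + rightPot p a j (r - 1) := by
    rw [← hright']
    refine Finset.sum_congr rfl fun k hk => ?_
    rw [Finset.mem_Ico] at hk
    rw [hbout k (by omega)]
  have hmidr : ∑ k ∈ Finset.Ico (i + 1) j, (p : ℝ) ^ (a i - a k) = rightPot p a i (j - 1) := by
    rw [rightPot, show j - 1 + 1 = j by omega]
  have hmidr' : ∑ k ∈ Finset.Ico (i + 1) j, (p : ℝ) ^ (a i - b k) = leftPot p a (i + 1) j := by
    rw [leftPot, ← hreflect fun k => (p : ℝ) ^ (a k - a j)]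
    refine Finset.sum_congr rfl fun k hk => ?_
    rw [Finset.mem_Ico] at hk
    rw [hbin k (by omega) (by omega)]
    congr 1
    ring
  have hmidl' : ∑ k ∈ Finset.Ico (i + 1) j, (p : ℝ) ^ (b k - a j) = rightPot p a i (j - 1) := by
    rw [← hmidr, ← hreflect fun k => (p : ℝ) ^ (b k - a j)]
    refine Finset.sum_congr rfl fun k hk => ?_
    rw [Finset.mem_Ico] at hk
    rw [hbin (i + j - k) (by omega) (by omega), show i + j - (i + j - k) = k by omega]
    congr 1
    ring
  rw [crossEnergy_eq_sum_mul_sum (a := b) (u := 0) hp0 (a i),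
    crossEnergy_eq_sum_mul_sum (a := b) (u' := j) hp0 (a j),
    crossEnergy_eq_sum_mul_sum (a := a) (u := 0) (v' := j) hp0 (a i),
    crossEnergy_eq_sum_mul_sum (a := a) (u := i + 1) (u' := j) hp0 (a j),
    sum_Ico_eq_one_add_leftPot (Nat.zero_le i), hleft, hright, hright', hmidr, hmidr', hmidl',
    ← leftPot] at hmin
  linarith

/-- In a minimizer with gaps `Q` and `Q + 1`, a stretch of `m + 2` gaps `Q` cannot lie to the left
of a block of at most `m` gaps `Q`. -/
lemma IsMinimizer.no_long_block_left (hp3 : 3 ≤ p) (ha : IsMinimizer p s r a) {Q : ℤ}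
    (hQ : ∀ k < r - 1, dlt a k = Q ∨ dlt a k = Q + 1) {u m z : ℕ}
    (hu : ∀ l < m + 2, dlt a (u + l) = Q) (huz : u + m + 2 < z) (hz : dlt a (z - 1) = Q + 1)
    (hzr : z + m ≤ r - 1) (hend : z + m < r - 1 → dlt a (z + m) = Q + 1) : False := by
  have hp0 : (p : ℝ) ≠ 0 := by norm_cast; omega
  have hpos := ha.1.dlt_pos
  have h1 := rightPot_lt_leftPot hp3 hpos m u z (by omega) (fun l hl => hu l (by omega)) hzr
    (fun l hl => by rcases hQ (z + l) (by omega) with h | h <;> omega) hend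
  have h2 : leftPot p a (u + m + 1 + 1) z < rightPot p a (u + m + 1) (z - 1) := by
    obtain ⟨w, rfl⟩ : ∃ w, z = w + 1 := ⟨z - 1, by omega⟩
    rw [Nat.add_sub_cancel] at hz ⊢
    rw [leftPot_succ hp0 (by omega), rightPot_of_lt hp0 (by omega), hz,
      show u + m + 1 = u + (m + 1) by ring, hu (m + 1) (by omega)]
    exact zpow_neg_pred_mul_lt hp3 le_rfl le_rfl (rightPot_nonneg _ _)
      (leftPot_lt_half hp3 (by omega) fun k hk => hpos k (by omega))
  have h3 := ha.reverse_segment hp3 (i := u + m + 1) (j := z) (by omega) (by omega)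
  nlinarith

lemma IsMinimizer.no_long_block_right (hp3 : 3 ≤ p) (ha : IsMinimizer p s r a) {Q : ℤ}
    (hQ : ∀ k < r - 1, dlt a k = Q ∨ dlt a k = Q + 1) {u m z : ℕ}
    (hu : ∀ l < m + 2, dlt a (u + l) = Q) (hur : u + m + 2 ≤ r - 1) (huz : z + m < u)
    (hz : dlt a (z + m) = Q + 1) (hend : 0 < z → dlt a (z - 1) = Q + 1) : False := by
  refine ha.reflect.no_long_block_left hp3 (Q := Q) (u := r - 1 - u - m - 2) (m := m)
    (z := r - 1 - z - m) ?_ ?_ (by omega) ?_ (by omega) ?_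
  · intro k hk
    rw [dlt_reflect hk]
    exact hQ _ (by omega)
  · intro l hl
    rw [dlt_reflect (by omega), ← hu (m + 1 - l) (by omega)]
    congr 1
    omega
  · rw [dlt_reflect (by omega), ← hz]
    congr 1
    omega
  · intro h
    rw [dlt_reflect (by omega), ← hend (by omega)]
    congr 1
    omega

end Exchange

section Blocks

lemma eq_or_eq_add_one_of_sum {N : ℕ} {y : ℕ → ℤ} {c : ℤ} {f : ℕ}
    (hy : ∀ i < N, ∀ j < N, y i ≤ y j + 1) (hf : f < N)
    (hsum : ∑ i ∈ Finset.range N, y i = c * N + f) :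
    (∀ i < N, y i = c ∨ y i = c + 1) ∧
      ((Finset.range N).filter fun i => y i = c + 1).card = f := by
  have hlow : ∀ i < N, c ≤ y i := by
    by_contra! h
    obtain ⟨i, hi, hic⟩ := h
    have : ∑ j ∈ Finset.range N, y j < ∑ j ∈ Finset.range N, c :=
      Finset.sum_lt_sum (fun j hj => by have := hy j (Finset.mem_range.1 hj) i hi; omega)
        ⟨i, Finset.mem_range.2 hi, hic⟩
    simp only [Finset.sum_const, Finset.card_range, nsmul_eq_mul] at this
    nlinarith
  have hup : ∀ i < N, y i ≤ c + 1 := by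
    by_contra! h
    obtain ⟨i, hi, hic⟩ := h
    have : ∑ j ∈ Finset.range N, (c + 1) ≤ ∑ j ∈ Finset.range N, y j :=
      Finset.sum_le_sum fun j hj => by have := hy i hi j (Finset.mem_range.1 hj); omega
    simp only [Finset.sum_const, Finset.card_range, nsmul_eq_mul] at this
    nlinarith
  have hval : ∀ i < N, y i = c ∨ y i = c + 1 := fun i hi => by
    have := hlow i hi
    have := hup i hi
    omega
  refine ⟨hval, ?_⟩
  have h1 : ∑ i ∈ Finset.range N, y i
      = ∑ i ∈ Finset.range N, (c + if y i = c + 1 then 1 else 0) := by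
    refine Finset.sum_congr rfl fun i hi => ?_
    rcases hval i (Finset.mem_range.1 hi) with h | h <;> simp [h]
  rw [Finset.sum_add_distrib, Finset.sum_boole, hsum] at h1
  simp only [Finset.sum_const, Finset.card_range, nsmul_eq_mul] at h1
  have h2 : ((((Finset.range N).filter fun i => y i = c + 1).card : ℕ) : ℤ) = f := by
    linarith
  exact_mod_cast h2

/-- Separators of the word `d 0, …, d (n - 1)`, with positions shifted by one: the entries different
from `v`, together with `0` and everything past the end. -/
def IsSep (n : ℕ) (d : ℕ → ℤ) (v : ℤ) (x : ℕ) : Prop :=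
  x = 0 ∨ n < x ∨ d (x - 1) ≠ v

/-- Increasing enumeration of the separators. -/
noncomputable def sepPos (n : ℕ) (d : ℕ → ℤ) (v : ℤ) (k : ℕ) : ℕ := Nat.nth (IsSep n d v) k

variable {n : ℕ} {d : ℕ → ℤ} {v : ℤ}

lemma infinite_isSep : {x | IsSep n d v x}.Infinite :=
  (Set.Ioi_infinite n).mono fun _ hx => Or.inr (Or.inl hx)

lemma sepPos_strictMono : StrictMono (sepPos n d v) := Nat.nth_strictMono infinite_isSep

lemma isSep_sepPos (k : ℕ) : IsSep n d v (sepPos n d v k) :=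
  Nat.nth_mem_of_infinite infinite_isSep k

lemma exists_sepPos_eq {x : ℕ} (hx : IsSep n d v x) : ∃ k, sepPos n d v k = x := by
  classical
  exact ⟨Nat.count (IsSep n d v) x, Nat.nth_count hx⟩

lemma sepPos_zero : sepPos n d v 0 = 0 := by
  obtain ⟨k, hk⟩ := exists_sepPos_eq (n := n) (d := d) (v := v) (Or.inl rfl : IsSep n d v 0)
  have := sepPos_strictMono.monotone (f := sepPos n d v) (Nat.zero_le k)
  omega

lemma sepPos_last :
    sepPos n d v (((Finset.range n).filter fun j => d j ≠ v).card + 1) = n + 1 := by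
  classical
  have hn : IsSep n d v (n + 1) := Or.inr (Or.inl n.lt_succ_self)
  have hcount : Nat.count (IsSep n d v) (n + 1)
      = ((Finset.range n).filter fun j => d j ≠ v).card + 1 := by
    have h0 : IsSep n d v 0 := Or.inl rfl
    rw [Nat.count_succ', if_pos h0, Nat.count_eq_card_filter_range]
    congr 2
    refine Finset.filter_congr fun j hj => ?_
    have : ¬ n < j + 1 := by rw [Finset.mem_range] at hj; omega
    simp [IsSep, this]
  rw [← hcount]
  exact Nat.nth_count hn

lemma eq_of_between_sepPos {k x : ℕ} (h1 : sepPos n d v k ≤ x) (h2 : x + 1 < sepPos n d v (k + 1)) :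
    d x = v := by
  by_contra h
  obtain ⟨l, hl⟩ := exists_sepPos_eq (n := n) (x := x + 1) (Or.inr (Or.inr h) : IsSep n d v (x + 1))
  have h3 : k < l := sepPos_strictMono.lt_iff_lt.1 (by omega : sepPos n d v k < sepPos n d v l)
  have h4 : l < k + 1 := sepPos_strictMono.lt_iff_lt.1 (hl ▸ h2)
  omega

lemma isMaxRun_iff {i l : ℕ} (hl : 0 < l) : IsMaxRun n d v i l ↔
    ∃ k, sepPos n d v k = i ∧ sepPos n d v (k + 1) = i + l + 1 ∧ i + l ≤ n := by
  constructor
  · rintro ⟨-, hin, hv, hleft, hright⟩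
    have hi : IsSep n d v i := by
      rcases i.eq_zero_or_pos with h | h
      · exact Or.inl h
      · exact Or.inr (Or.inr (hleft h))
    have hil : IsSep n d v (i + l + 1) := by
      rcases hin.eq_or_lt with h | h
      · exact Or.inr (Or.inl (by omega))
      · exact Or.inr (Or.inr (hright h))
    obtain ⟨k, hk⟩ := exists_sepPos_eq hi
    obtain ⟨k', hk'⟩ := exists_sepPos_eq hil
    have hkk' : k < k' :=
      sepPos_strictMono.lt_iff_lt.1 (by omega : sepPos n d v k < sepPos n d v k')
    have hle := sepPos_strictMono.monotone (f := sepPos n d v) (Nat.succ_le_of_lt hkk')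
    have hlt : sepPos n d v k < sepPos n d v (k + 1) := sepPos_strictMono k.lt_succ_self
    refine ⟨k, hk, ?_, hin⟩
    by_contra hne
    simp only [Nat.succ_eq_add_one] at hle
    rcases isSep_sepPos (n := n) (d := d) (v := v) (k + 1) with h | h | h
    · omega
    · omega
    · refine h ?_
      have := hv (sepPos n d v (k + 1) - 1 - i) (by omega)
      rwa [show i + (sepPos n d v (k + 1) - 1 - i) = sepPos n d v (k + 1) - 1 by omega] at this
  · rintro ⟨k, hk, hk', hin⟩
    refine ⟨hl, hin, ?_, ?_, ?_⟩
    · intro x hx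
      exact eq_of_between_sepPos (n := n) (k := k) (by omega) (by omega)
    · intro h0
      rcases isSep_sepPos (n := n) (d := d) (v := v) k with h | h | h
      · omega
      · omega
      · rwa [hk] at h
    · intro h0
      rcases isSep_sepPos (n := n) (d := d) (v := v) (k + 1) with h | h | h
      · omega
      · omega
      · rwa [hk', Nat.add_sub_cancel] at h

lemma setOf_isMaxRun_ncard {g l : ℕ} (hl : 0 < l) (hlast : sepPos n d v (g + 1) = n + 1) :
    {i | IsMaxRun n d v i l}.ncard = ((Finset.range (g + 1)).filter fun k =>
      (sepPos n d v (k + 1) : ℤ) - sepPos n d v k - 1 = l).card := by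
  rw [← Set.ncard_coe_finset]
  refine Eq.trans ?_ (Set.ncard_image_of_injective _ (sepPos_strictMono (n := n) (d := d)
    (v := v)).injective)
  congr 1
  ext i
  simp only [Set.mem_ofPred_eq, isMaxRun_iff hl, Set.mem_image, Finset.coe_filter,
    Finset.mem_range]
  constructor
  · rintro ⟨k, hk, hk', hin⟩
    refine ⟨k, ⟨?_, by omega⟩, hk⟩
    have : k + 1 ≤ g + 1 := sepPos_strictMono.le_iff_le.1
      (by omega : sepPos n d v (k + 1) ≤ sepPos n d v (g + 1))
    omega
  · rintro ⟨k, ⟨hk, hk'⟩, rfl⟩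
    have := sepPos_strictMono.monotone (f := sepPos n d v) (show k + 1 ≤ g + 1 by omega)
    exact ⟨k, rfl, by omega, by omega⟩

/-- In a minimizer with gaps `Q` and `Q + 1`, any two blocks of gaps `Q` have almost equal
length. -/
lemma IsMinimizer.block_le {p s r g : ℕ} {a : ℕ → ℤ} (hp3 : 3 ≤ p) (ha : IsMinimizer p s r a)
    {Q : ℤ} (hQ : ∀ k < r - 1, dlt a k = Q ∨ dlt a k = Q + 1)
    (hlast : sepPos (r - 1) (dlt a) Q (g + 1) = r - 1 + 1) {i j : ℕ} (hi : i < g + 1)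
    (hj : j < g + 1) :
    (sepPos (r - 1) (dlt a) Q (i + 1) : ℤ) - sepPos (r - 1) (dlt a) Q i - 1
      ≤ (sepPos (r - 1) (dlt a) Q (j + 1) : ℤ) - sepPos (r - 1) (dlt a) Q j - 1 + 1 := by
  by_contra! hlt
  have hsep : ∀ k, 0 < sepPos (r - 1) (dlt a) Q k → sepPos (r - 1) (dlt a) Q k ≤ r - 1 →
      dlt a (sepPos (r - 1) (dlt a) Q k - 1) = Q + 1 := by
    intro k h0 h1
    rcases isSep_sepPos (n := r - 1) (d := dlt a) (v := Q) k with h | h | h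
    · omega
    · omega
    · exact (hQ _ (by omega)).resolve_left h
  have hmono := sepPos_strictMono (n := r - 1) (d := dlt a) (v := Q)
  have hbetween := fun x => eq_of_between_sepPos (n := r - 1) (d := dlt a) (v := Q) (k := i) (x := x)
  have hi1 := hmono.monotone (show i + 1 ≤ g + 1 by omega)
  have hj1 := hmono.monotone (show j + 1 ≤ g + 1 by omega)
  have hjj := hmono (show j < j + 1 by omega)
  have hsj := hsep j
  have hsj1 := hsep (j + 1)
  obtain ⟨m, hm⟩ : ∃ m, sepPos (r - 1) (dlt a) Q (j + 1) = sepPos (r - 1) (dlt a) Q j + m + 1 :=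
    ⟨sepPos (r - 1) (dlt a) Q (j + 1) - sepPos (r - 1) (dlt a) Q j - 1, by omega⟩
  rw [hm, Nat.add_sub_cancel] at hsj1
  rcases lt_trichotomy i j with hij | rfl | hij
  · have := hmono.monotone (show i + 1 ≤ j by omega)
    refine ha.no_long_block_left hp3 hQ (u := sepPos (r - 1) (dlt a) Q i) (m := m)
      (z := sepPos (r - 1) (dlt a) Q j) (fun l hl => hbetween _ (by omega) (by omega)) (by omega)
      (hsj (by omega) (by omega)) (by omega) (fun _ => hsj1 (by omega) (by omega))
  · omega
  · have := hmono.monotone (show j + 1 ≤ i by omega)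
    refine ha.no_long_block_right hp3 hQ (u := sepPos (r - 1) (dlt a) Q i) (m := m)
      (z := sepPos (r - 1) (dlt a) Q j) (fun l hl => hbetween _ (by omega) (by omega)) (by omega)
      (by omega) (hsj1 (by omega) (by omega)) (fun h => hsj h (by omega))

end Blocks

/-- Theorem 2.2(iv): if `(r-1) ∤ (s-1)`, `(r-1) ∤ s`, `g ≡ s-1 mod (r-1)` is the least
positive residue, `2g ≤ r-2` and `(g+1) ∤ (r-g-1)` with `q₁ = (r-g-1)/(g+1)`, then the
delta vector `d` of any minimizer has exactly `g` entries `[q]+1`, with `d_1 ≠ [q]+1`,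
`d_{r-1} ≠ [q]+1` and no two adjacent entries `[q]+1`; the remaining `r-g-1` entries all
equal `[q]`, appearing in maximal blocks of length `[q₁]` or `[q₁]+1`, with exactly `f`
blocks of length `[q₁]+1` and exactly `g+1-f` blocks of length `[q₁]`, where
`f ≡ r-g-1 mod (g+1)` is the least positive residue. -/
theorem stmt7 (p s r : ℕ) (hpp : p.Prime) (hp3 : 3 ≤ p) (hr : 3 ≤ r) (hrs : r < s)
    (hndvd1 : ¬ (r - 1) ∣ (s - 1)) (hndvd2 : ¬ (r - 1) ∣ s)
    (g : ℕ) (hgdef : g = (s - 1) % (r - 1))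
    (hg : 2 * g ≤ r - 2) (hq1 : ¬ (g + 1) ∣ (r - g - 1))
    (fq : ℤ) (hfq : fq = (((s - 1) / (r - 1) : ℕ) : ℤ))
    (q1f f : ℕ) (hq1f : q1f = (r - g - 1) / (g + 1)) (hf : f = (r - g - 1) % (g + 1))
    (a : ℕ → ℤ) (ha : IsMinimizer p s r a) :
    ((Finset.range (r - 1)).filter (fun j => dlt a j = fq + 1)).card = g ∧
    dlt a 0 ≠ fq + 1 ∧ dlt a (r - 2) ≠ fq + 1 ∧
    (∀ j, j + 1 < r - 1 → ¬ (dlt a j = fq + 1 ∧ dlt a (j + 1) = fq + 1)) ∧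
    (∀ j < r - 1, dlt a j = fq ∨ dlt a j = fq + 1) ∧
    (∀ i l, IsMaxRun (r - 1) (dlt a) fq i l → l = q1f ∨ l = q1f + 1) ∧
    {i | IsMaxRun (r - 1) (dlt a) fq i (q1f + 1)}.ncard = f ∧
    {i | IsMaxRun (r - 1) (dlt a) fq i q1f}.ncard = g + 1 - f := by
  have hsub : (((s - 1 : ℕ) : ℤ)) = (s : ℤ) - 1 := by push_cast [show 1 ≤ s by omega]; ring
  have hgr : g < r - 1 := by rw [hgdef]; exact Nat.mod_lt _ (by omega)
  have hsum : ∑ j ∈ Finset.range (r - 1), dlt a j = fq * (r - 1 : ℕ) + g := by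
    have h1 : ∑ j ∈ Finset.range (r - 1), dlt a j = (s : ℤ) - 1 := by
      simp only [dlt]
      rw [Finset.sum_range_sub, ha.1.1, ha.1.2.1, sub_zero]
    have h2 := Nat.div_add_mod' (s - 1) (r - 1)
    rw [h1, hfq, hgdef, ← hsub]
    exact_mod_cast h2.symm
  obtain ⟨hval, hcard⟩ := eq_or_eq_add_one_of_sum
    (fun i hi j hj => ha.dlt_le hp3 hi hj) hgr hsum
  have hlast : sepPos (r - 1) (dlt a) fq (g + 1) = r - 1 + 1 := by
    rw [← hcard, ← sepPos_last (n := r - 1) (d := dlt a) (v := fq)]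
    congr 3
    refine Finset.filter_congr fun j hj => ?_
    rcases hval j (Finset.mem_range.1 hj) with h | h <;> simp [h]
  have hfg : f < g + 1 := by rw [hf]; exact Nat.mod_lt _ (by omega)
  have hblocks : ∑ k ∈ Finset.range (g + 1), ((sepPos (r - 1) (dlt a) fq (k + 1) : ℤ)
      - sepPos (r - 1) (dlt a) fq k - 1) = q1f * (g + 1 : ℕ) + f := by
    have h2 := Nat.div_add_mod' (r - g - 1) (g + 1)
    rw [← hq1f, ← hf] at h2
    rw [Finset.sum_sub_distrib,
      Finset.sum_range_sub fun k => (sepPos (r - 1) (dlt a) fq k : ℤ), hlast, sepPos_zero]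
    simp only [Finset.sum_const, Finset.card_range, nsmul_eq_mul, mul_one]
    have h3 : ((r - g - 1 : ℕ) : ℤ) = q1f * (g + 1 : ℕ) + f := by exact_mod_cast h2.symm
    rw [← h3]
    omega
  obtain ⟨hbval, hbcard⟩ := eq_or_eq_add_one_of_sum
    (fun i hi j hj => ha.block_le hp3 hval hlast hi hj) hfg hblocks
  have hq1pos : 0 < q1f := by rw [hq1f]; exact Nat.div_pos (by omega) (by omega)
  have hmono := sepPos_strictMono (n := r - 1) (d := dlt a) (v := fq)
  have hgap : ∀ k < g + 1, sepPos (r - 1) (dlt a) fq k + 2 ≤ sepPos (r - 1) (dlt a) fq (k + 1) := by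
    intro k hk
    rcases hbval k hk with h | h <;> omega
  have hfar : ∀ x y, IsSep (r - 1) (dlt a) fq x → IsSep (r - 1) (dlt a) fq y → x < y →
      y ≤ r → x + 2 ≤ y := by
    intro x y hx hy hxy hyr
    obtain ⟨k, rfl⟩ := exists_sepPos_eq hx
    obtain ⟨l, rfl⟩ := exists_sepPos_eq hy
    have hkl := hmono.lt_iff_lt.1 hxy
    have hlg : l ≤ g + 1 := hmono.le_iff_le.1 (by omega)
    exact (hgap k (by omega)).trans (hmono.monotone hkl)
  have hne : ∀ j, dlt a j = fq + 1 → IsSep (r - 1) (dlt a) fq (j + 1) := by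
    intro j hj
    refine Or.inr (Or.inr ?_)
    rw [Nat.add_sub_cancel, hj]
    omega
  refine ⟨hcard, ?_, ?_, ?_, hval, ?_, ?_, ?_⟩
  · intro h
    have := hfar 0 1 (Or.inl rfl) (hne 0 h) (by omega) (by omega)
    omega
  · intro h
    have := hfar (r - 1) r (by simpa [show r - 2 + 1 = r - 1 by omega] using hne _ h)
      (Or.inr (Or.inl (by omega))) (by omega) le_rfl
    omega
  · rintro j hj ⟨h1, h2⟩
    have := hfar _ _ (hne _ h1) (hne _ h2) (by omega) (by omega)
    omega
  · intro i l hrun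
    obtain ⟨k, hk, hk', hin⟩ := (isMaxRun_iff hrun.1).1 hrun
    have hkg : k + 1 ≤ g + 1 := hmono.le_iff_le.1 (by omega)
    rcases hbval k (by omega) with h | h <;> omega
  · rw [setOf_isMaxRun_ncard (by omega) hlast, ← hbcard]
    push_cast
    rfl
  · rw [setOf_isMaxRun_ncard hq1pos hlast]
    have h := Finset.card_filter_add_card_filter_not (s := Finset.range (g + 1)) fun k =>
      (sepPos (r - 1) (dlt a) fq (k + 1) : ℤ) - sepPos (r - 1) (dlt a) fq k - 1 = q1f + 1
    rw [hbcard, Finset.card_range] at h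
    refine (congrArg Finset.card (Finset.filter_congr fun k hk => ?_)).trans
      (Nat.eq_sub_of_add_eq' h)
    have := hbval k (Finset.mem_range.1 hk)
    omega
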